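/- Let $T>0$ and $H\in(\tfrac23,1)$. Then $\lim_{\varepsilon\to0^+}\varepsilon^{3-\frac2H}\cdot \frac1\pi\int_{\mathcal{S}} \big(\varepsilon+(t_1-s_1)^{2H}\big)^{-3/2}\big(\varepsilon+(t_2-s_2)^{2H}\big)^{-3/2}\,\mu_H(s_2-s_1,\,t_1-s_1,\,t_2-s_2)\; ds_1\, ds_2\, dt_1\, dt_2 = \sigma^2$, where $\sigma^2 := \frac{T^{2H}(2H-1)}{4H\pi}\, B\big(\tfrac1H,\tfrac{3H-2}{2H}\big)^2\, B(2,2H-1)$. (This integral equals $\tfrac12\,\mathbb{E}[I_1(f_{1,\varepsilon})^2]$, the variance of the first Wiener chaos component of the approximating derivative of self-intersection local time; thus $\varepsilon^{3-2/H}\,\mathbb{E}[I_1(f_{1,\varepsilon})^2]\to\sigma^2$.) -/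

import Mathlib

open Real Set MeasureTheory Filter

/-- The covariance `𝔼[B_{u₁}(B_{x+u₂} - B_x)]` of a fractional Brownian motion of
Hurst parameter `H`. -/
noncomputable def mu (H x u₁ u₂ : ℝ) : ℝ :=
  (1/2) * ((x + u₂) ^ (2*H) - x ^ (2*H) - |x + u₂ - u₁| ^ (2*H) + |x - u₁| ^ (2*H))

/-- The Euler Beta function `B(p,q) = ∫₀¹ x^{p-1}(1-x)^{q-1} dx`. -/
noncomputable def betaFn (p q : ℝ) : ℝ := ∫ x in (0:ℝ)..1, x ^ (p - 1) * (1 - x) ^ (q - 1)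

/-- The region `𝒮 = {(s₁,s₂,t₁,t₂) ∈ [0,T]⁴ : s₁ ≤ t₁, s₂ ≤ t₂, s₁ ≤ s₂}`. -/
def regS (T : ℝ) : Set (ℝ × ℝ × ℝ × ℝ) :=
  {p | p.1 ∈ Icc (0:ℝ) T ∧ p.2.1 ∈ Icc (0:ℝ) T ∧ p.2.2.1 ∈ Icc (0:ℝ) T ∧
    p.2.2.2 ∈ Icc (0:ℝ) T ∧ p.1 ≤ p.2.2.1 ∧ p.2.1 ≤ p.2.2.2 ∧ p.1 ≤ p.2.1}

/-- Half of the variance `𝔼[I₁(f₁,ε)²]` of the first Wiener chaos component of the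
approximating derivative of self-intersection local time, written as an integral over `𝒮`. -/
noncomputable def halfVarFirstChaos (H T ε : ℝ) : ℝ :=
  (1/π) * ∫ p in regS T,
    (ε + (p.2.2.1 - p.1) ^ (2*H)) ^ (-(3/2 : ℝ)) *
      (ε + (p.2.2.2 - p.2.1) ^ (2*H)) ^ (-(3/2 : ℝ)) *
      mu H (p.2.1 - p.1) (p.2.2.1 - p.1) (p.2.2.2 - p.2.1)

/-- The signed power `y ↦ |y|^{a-2} y`, with `1 < a ≤ 2`, has increments over `[y - u, y]`
bounded by `2 u y^{a-2}`. -/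
lemma abs_signed_rpow_sub_le {a y u : ℝ} (ha : 1 < a) (ha2 : a ≤ 2) (hy : 0 < y) (hu : 0 ≤ u) :
    |(|y| ^ (a - 2) * y) - |y - u| ^ (a - 2) * (y - u)| ≤ 2 * u * y ^ (a - 2) := by
  have key : ∀ z : ℝ, 0 < z → z ^ (a - 2) * z = z ^ (a - 1) := fun z hz => by
    rw [← rpow_add_one hz.ne']; ring_nf
  have hya : 0 < y ^ (a - 2) := rpow_pos_of_pos hy _
  have huy : 0 ≤ u * y ^ (a - 2) := by positivity
  rw [abs_of_pos hy]
  rcases lt_trichotomy u y with h | h | h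
  · have hz : 0 < y - u := by linarith
    rw [abs_of_pos hz]
    have h1 : (y - u) ^ (a - 2) * (y - u) ≤ y ^ (a - 2) * y := by
      rw [key _ hz, key _ hy]
      exact rpow_le_rpow hz.le (by linarith) (by linarith)
    have h2 : y ^ (a - 2) * (y - u) ≤ (y - u) ^ (a - 2) * (y - u) :=
      mul_le_mul_of_nonneg_right (rpow_le_rpow_of_nonpos hz (by linarith) (by linarith)) hz.le
    rw [abs_of_nonneg (by linarith)]
    linarith
  · subst h
    simp only [sub_self, mul_zero, sub_zero]
    rw [abs_of_pos (by positivity)]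
    linarith
  · have hz : 0 < u - y := by linarith
    have hup : 0 < u := by linarith
    rw [abs_sub_comm y u, abs_of_pos hz]
    have h1 : (u - y) ^ (a - 2) * (u - y) ≤ u * y ^ (a - 2) := by
      calc (u - y) ^ (a - 2) * (u - y) = (u - y) ^ (a - 1) := key _ hz
        _ ≤ u ^ (a - 1) := rpow_le_rpow hz.le (by linarith) (by linarith)
        _ = u * u ^ (a - 2) := by rw [← key _ hup, mul_comm]
        _ ≤ u * y ^ (a - 2) :=
          mul_le_mul_of_nonneg_left (rpow_le_rpow_of_nonpos hy h.le (by linarith)) hup.le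
    have h2 : y ^ (a - 2) * y ≤ u * y ^ (a - 2) := by nlinarith
    have h3 : 0 ≤ (u - y) ^ (a - 2) * (u - y) := by positivity
    have h4 : 0 ≤ y ^ (a - 2) * y := by positivity
    rw [show y - u = -(u - y) by ring, mul_neg, sub_neg_eq_add, abs_of_nonneg (by linarith)]
    linarith

/-- The derivative of the increment `y ↦ |y|^a - |y - u|^a`. -/
lemma hasDerivAt_abs_rpow_sub {a : ℝ} (ha : 1 < a) (u y : ℝ) :
    HasDerivAt (fun y : ℝ => |y| ^ a - |y - u| ^ a)
      (a * (|y| ^ (a - 2) * y - |y - u| ^ (a - 2) * (y - u))) y := by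
  have h1 := hasDerivAt_abs_rpow y ha
  have h2 := (hasDerivAt_abs_rpow (y - u) ha).comp y ((hasDerivAt_id y).sub_const u)
  refine (h1.sub h2).congr_deriv ?_
  ring

lemma mu_eq_increment {H x u₁ u₂ : ℝ} (hx : 0 ≤ x) (hu₂ : 0 ≤ u₂) :
    mu H x u₁ u₂ = (1/2) * ((|x + u₂| ^ (2*H) - |x + u₂ - u₁| ^ (2*H)) -
      (|x| ^ (2*H) - |x - u₁| ^ (2*H))) := by
  rw [mu, abs_of_nonneg hx, abs_of_nonneg (add_nonneg hx hu₂)]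
  ring

lemma abs_mu_le {H x u₁ u₂ : ℝ} (hH : 1/2 < H) (hH1 : H ≤ 1) (hx : 0 < x) (hu₁ : 0 ≤ u₁)
    (hu₂ : 0 ≤ u₂) : |mu H x u₁ u₂| ≤ 2 * H * (u₁ * u₂ * x ^ (2*H - 2)) := by
  have hmvt := Convex.norm_image_sub_le_of_norm_hasDerivWithin_le
    (f := fun y : ℝ => |y| ^ (2*H) - |y - u₁| ^ (2*H)) (s := Icc x (x + u₂))
    (x := x) (y := x + u₂) (C := 2 * H * (2 * u₁ * x ^ (2*H - 2)))
    (fun y _ => (hasDerivAt_abs_rpow_sub (by linarith) u₁ y).hasDerivWithinAt)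
    (fun y hy => by
      rw [norm_eq_abs, abs_mul, abs_of_pos (by linarith : 0 < 2 * H)]
      refine mul_le_mul_of_nonneg_left ?_ (by linarith)
      refine (abs_signed_rpow_sub_le (by linarith) (by linarith) (hx.trans_le hy.1) hu₁).trans ?_
      exact mul_le_mul_of_nonneg_left (rpow_le_rpow_of_nonpos hx hy.1 (by linarith))
        (by positivity))
    (convex_Icc _ _) ⟨le_rfl, by linarith⟩ ⟨by linarith, le_rfl⟩
  rw [mu_eq_increment hx.le hu₂, abs_mul, abs_of_pos (by norm_num : (0:ℝ) < 1/2)]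
  simp only [norm_eq_abs, add_sub_cancel_left, abs_of_nonneg hu₂] at hmvt
  nlinarith

lemma exists_mu_eq {H x u₁ u₂ : ℝ} (hH : 1/2 < H) (hu₁ : 0 < u₁) (hxu : u₁ < x)
    (hu₂ : 0 < u₂) :
    ∃ η ∈ Ioo (x - u₁) (x + u₂), mu H x u₁ u₂ = H * (2*H - 1) * η ^ (2*H - 2) * (u₁ * u₂) := by
  have hd := hasDerivAt_abs_rpow_sub (a := 2*H) (by linarith) u₁
  obtain ⟨ξ, hξ, hξe⟩ := exists_hasDerivAt_eq_slope _ _ (by linarith : x < x + u₂)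
    (fun y _ => (hd y).continuousAt.continuousWithinAt) (fun y _ => hd y)
  have hξ0 : 0 < ξ - u₁ := by linarith [hξ.1]
  have hp : ∀ y ∈ Icc (ξ - u₁) ξ, HasDerivAt (fun y : ℝ => y ^ (2*H - 1))
      ((2*H - 1) * y ^ (2*H - 1 - 1)) y := fun y hy =>
    hasDerivAt_rpow_const (Or.inl (by linarith [hy.1]))
  obtain ⟨η, hη, hηe⟩ := exists_hasDerivAt_eq_slope _ _ (by linarith : ξ - u₁ < ξ)
    (fun y hy => (hp y hy).continuousAt.continuousWithinAt)
    (fun y hy => hp y (Ioo_subset_Icc_self hy))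
  refine ⟨η, ⟨by linarith [hξ.1, hη.1], by linarith [hξ.2, hη.2]⟩, ?_⟩
  have key : ∀ z : ℝ, 0 < z → |z| ^ (2*H - 2) * z = z ^ (2*H - 1) := fun z hz => by
    rw [abs_of_pos hz, ← rpow_add_one hz.ne']; ring_nf
  rw [key _ (by linarith), key _ hξ0, add_sub_cancel_left, eq_div_iff hu₂.ne'] at hξe
  rw [sub_sub_cancel, eq_div_iff hu₁.ne', show 2*H - 1 - 1 = 2*H - 2 by ring] at hηe
  rw [mu_eq_increment (by linarith) hu₂.le, ← hξe, ← hηe]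
  ring

lemma tendsto_mu_div_sq {H x v₁ v₂ : ℝ} (hH : 1/2 < H) (hx : 0 < x) (hv₁ : 0 < v₁)
    (hv₂ : 0 < v₂) :
    Tendsto (fun δ : ℝ => mu H x (δ * v₁) (δ * v₂) / δ ^ 2) (nhdsWithin 0 (Ioi 0))
      (nhds (H * (2*H - 1) * x ^ (2*H - 2) * (v₁ * v₂))) := by
  have hev : ∀ᶠ δ : ℝ in nhdsWithin 0 (Ioi 0), δ * v₁ < x := by
    have : Tendsto (fun δ : ℝ => δ * v₁) (nhds 0) (nhds (0 * v₁)) :=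
      (by fun_prop : Continuous fun δ : ℝ => δ * v₁).tendsto 0
    rw [zero_mul] at this
    exact (this.mono_left nhdsWithin_le_nhds).eventually_lt_const hx
  have hex : ∀ δ : ℝ, ∃ η, 0 < δ → δ * v₁ < x → η ∈ Ioo (x - δ * v₁) (x + δ * v₂) ∧
      mu H x (δ * v₁) (δ * v₂) =
        H * (2*H - 1) * η ^ (2*H - 2) * ((δ * v₁) * (δ * v₂)) := fun δ => by
    by_cases h : 0 < δ ∧ δ * v₁ < x
    · obtain ⟨η, h1, h2⟩ := exists_mu_eq hH (mul_pos h.1 hv₁) h.2 (mul_pos h.1 hv₂)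
      exact ⟨η, fun _ _ => ⟨h1, h2⟩⟩
    · exact ⟨0, fun h1 h2 => absurd ⟨h1, h2⟩ h⟩
  choose η hη using hex
  have hηx : Tendsto η (nhdsWithin 0 (Ioi 0)) (nhds x) := by
    have hl : Tendsto (fun δ : ℝ => x - δ * v₁) (nhds 0) (nhds (x - 0 * v₁)) :=
      (by fun_prop : Continuous fun δ : ℝ => x - δ * v₁).tendsto 0
    have hr : Tendsto (fun δ : ℝ => x + δ * v₂) (nhds 0) (nhds (x + 0 * v₂)) :=
      (by fun_prop : Continuous fun δ : ℝ => x + δ * v₂).tendsto 0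
    rw [zero_mul, sub_zero] at hl
    rw [zero_mul, add_zero] at hr
    refine tendsto_of_tendsto_of_tendsto_of_le_of_le' (hl.mono_left nhdsWithin_le_nhds)
      (hr.mono_left nhdsWithin_le_nhds) ?_ ?_
    all_goals
      filter_upwards [hev, self_mem_nhdsWithin] with δ h1 h2
      obtain ⟨⟨h3, h4⟩, -⟩ := hη δ h2 h1
      linarith
  have hlim := ((hηx.rpow_const (p := 2*H - 2) (Or.inl hx.ne')).const_mul
    (H * (2*H - 1))).mul_const (v₁ * v₂)
  refine hlim.congr' ?_
  filter_upwards [hev, self_mem_nhdsWithin] with δ h1 h2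
  rw [(hη δ h2 h1).2]
  have : δ ≠ 0 := (mem_Ioi.1 h2).ne'
  field_simp

/-- The profile `v (1 + v^{2H})^{-3/2}` on the positive half-line, extended by zero. -/
noncomputable def profile (H : ℝ) : ℝ → ℝ :=
  (Ioi (0:ℝ)).indicator fun v => v * (1 + v ^ (2*H)) ^ (-(3/2 : ℝ))

lemma integrable_profile {H : ℝ} (hH : 2/3 < H) : Integrable (profile H) := by
  rw [profile, integrable_indicator_iff measurableSet_Ioi,
    ← Ioc_union_Ioi_eq_Ioi (zero_le_one' ℝ)]
  have hm : Measurable fun v : ℝ => v * (1 + v ^ (2*H)) ^ (-(3/2 : ℝ)) := by fun_prop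
  refine IntegrableOn.union ?_ ?_
  · refine Measure.integrableOn_of_bounded (M := 1) (by simp) hm.aestronglyMeasurable ?_
    filter_upwards [ae_restrict_mem measurableSet_Ioc] with v hv
    have h0 : 0 ≤ v ^ (2*H) := rpow_nonneg hv.1.le _
    have h1 : (1 + v ^ (2*H)) ^ (-(3/2 : ℝ)) ≤ 1 :=
      rpow_le_one_of_one_le_of_nonpos (by linarith) (by norm_num)
    have h2 : 0 ≤ (1 + v ^ (2*H)) ^ (-(3/2 : ℝ)) := by positivity
    rw [norm_of_nonneg (mul_nonneg hv.1.le h2)]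
    exact mul_le_one₀ hv.2 h2 h1
  · refine Integrable.mono' (integrableOn_Ioi_rpow_of_lt (a := 1 - 3*H) (by linarith) one_pos)
      hm.aestronglyMeasurable ?_
    filter_upwards [ae_restrict_mem measurableSet_Ioi] with v hv
    have hv0 : 0 < v := one_pos.trans hv
    have h0 : 0 < v ^ (2*H) := rpow_pos_of_pos hv0 _
    rw [norm_of_nonneg (by positivity)]
    calc v * (1 + v ^ (2*H)) ^ (-(3/2 : ℝ)) ≤ v * (v ^ (2*H)) ^ (-(3/2 : ℝ)) :=
          mul_le_mul_of_nonneg_left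
            (rpow_le_rpow_of_nonpos h0 (by linarith) (by norm_num)) hv0.le
      _ = v ^ (1 - 3*H) := by
          rw [← rpow_mul hv0.le, mul_comm, ← rpow_add_one hv0.ne']
          ring_nf

lemma image_one_sub_inv_one_add_rpow {a : ℝ} (ha : 0 < a) :
    (fun v : ℝ => 1 - (1 + v ^ a)⁻¹) '' Ioi 0 = Ioo 0 1 := by
  ext y
  constructor
  · rintro ⟨v, hv, rfl⟩
    have h : 0 < v ^ a := rpow_pos_of_pos hv _
    have h1 : (1 + v ^ a)⁻¹ < 1 := inv_lt_one_of_one_lt₀ (by linarith)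
    have h2 : 0 < (1 + v ^ a)⁻¹ := by positivity
    exact ⟨by linarith, by linarith⟩
  · rintro ⟨hy0, hy1⟩
    have h1 : 0 < 1 - y := by linarith
    refine ⟨(y / (1 - y)) ^ a⁻¹, rpow_pos_of_pos (by positivity) _, ?_⟩
    simp only
    rw [rpow_inv_rpow (by positivity) ha.ne']
    field_simp
    ring

lemma integral_profile {H : ℝ} (hH : 2/3 < H) :
    ∫ v, profile H v = betaFn (1/H) ((3*H - 2) / (2*H)) / (2*H) := by
  have hH0 : 0 < H := by linarith
  have hpos : ∀ v ∈ Ioi (0:ℝ), 0 < 1 + v ^ (2*H) := fun v hv => by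
    have := rpow_pos_of_pos (mem_Ioi.1 hv) (2*H)
    linarith
  have hderiv : ∀ v ∈ Ioi (0:ℝ), HasDerivWithinAt (fun v : ℝ => 1 - (1 + v ^ (2*H))⁻¹)
      (2 * H * v ^ (2*H - 1) / (1 + v ^ (2*H)) ^ 2) (Ioi 0) v := fun v hv => by
    have h := (((hasDerivAt_rpow_const (p := 2*H) (Or.inl (mem_Ioi.1 hv).ne')).const_add 1).inv
      (hpos v hv).ne').const_sub 1
    refine (h.congr_deriv ?_).hasDerivWithinAt
    ring
  have hinj : InjOn (fun v : ℝ => 1 - (1 + v ^ (2*H))⁻¹) (Ioi 0) := fun v hv w hw h => by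
    have h' : v ^ (2*H) = w ^ (2*H) := by simpa using h
    exact (rpow_left_inj (mem_Ioi.1 hv).le (mem_Ioi.1 hw).le (by linarith)).1 h'
  have hcv := integral_image_eq_integral_abs_deriv_smul measurableSet_Ioi hderiv hinj
    (fun x => x ^ (1/H - 1) * (1 - x) ^ ((3*H - 2) / (2*H) - 1))
  rw [image_one_sub_inv_one_add_rpow (by linarith : 0 < 2*H)] at hcv
  rw [betaFn, intervalIntegral.integral_of_le zero_le_one, integral_Ioc_eq_integral_Ioo, hcv,
    profile, integral_indicator measurableSet_Ioi, ← integral_div]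
  refine setIntegral_congr_fun measurableSet_Ioi fun v hv => ?_
  have hv0 : 0 < v := hv
  have hw := rpow_pos_of_pos hv0 (2*H)
  have hw1 := hpos v hv
  have e1 : 1 - (1 + v ^ (2*H))⁻¹ = v ^ (2*H) * (1 + v ^ (2*H))⁻¹ := by field_simp; ring
  have e2 : (v ^ (2*H)) ^ (1/H - 1) * v ^ (2*H - 1) = v := by
    rw [← rpow_mul hv0.le, ← rpow_add hv0]
    have : 2 * H * (1/H - 1) + (2*H - 1) = 1 := by field_simp; ring
    rw [this, rpow_one]
  have e3 : ((1 + v ^ (2*H))⁻¹) ^ (1/H - 1) * ((1 + v ^ (2*H))⁻¹) ^ ((3*H - 2) / (2*H) - 1) /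
      (1 + v ^ (2*H)) ^ 2 = (1 + v ^ (2*H)) ^ (-(3/2 : ℝ)) := by
    rw [← rpow_add (by positivity), inv_rpow hw1.le, ← rpow_neg hw1.le, ← rpow_natCast,
      ← rpow_sub hw1]
    congr 1
    push_cast
    field_simp
    ring
  have hnn : 0 ≤ 2 * H * v ^ (2*H - 1) / (1 + v ^ (2*H)) ^ 2 := by positivity
  simp only [smul_eq_mul, abs_of_nonneg hnn, sub_sub_cancel]
  rw [e1, mul_rpow hw.le (by positivity), ← e3]
  nth_rewrite 1 [← e2]
  field_simp

lemma betaFn_two {q : ℝ} (hq : 0 < q) : betaFn 2 q = 1 / (q * (q + 1)) := by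
  have h := intervalIntegral.integral_comp_sub_left (a := 0) (b := 1)
    (fun x : ℝ => (1 - x) * x ^ (q - 1)) 1
  have hb : betaFn 2 q = ∫ x in (0:ℝ)..1, (1 - (1 - x)) * (1 - x) ^ (q - 1) := by
    rw [betaFn]
    congr 1
    ext x
    norm_num
  rw [hb, h, sub_zero, sub_self]
  have e : EqOn (fun x : ℝ => (1 - x) * x ^ (q - 1)) (fun x => x ^ (q - 1) - x ^ q)
      (uIcc 0 1) := fun x hx => by
    rw [uIcc_of_le zero_le_one] at hx
    rcases hx.1.eq_or_lt with rfl | hx0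
    · rcases eq_or_ne q 1 with rfl | hq1
      · simp
      · simp [zero_rpow hq.ne', zero_rpow (sub_ne_zero.2 hq1)]
    · have : x ^ q = x ^ (q - 1) * x := by rw [← rpow_add_one hx0.ne']; ring_nf
      simp only [this]
      ring
  rw [intervalIntegral.integral_congr e, intervalIntegral.integral_sub
    (intervalIntegral.intervalIntegrable_rpow' (by linarith))
    (intervalIntegral.intervalIntegrable_rpow' (by linarith)),
    integral_rpow (Or.inl (by linarith)), integral_rpow (Or.inl (by linarith))]
  simp only [one_rpow, sub_add_cancel, zero_rpow hq.ne', zero_rpow (by linarith : q + 1 ≠ 0)]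
  field_simp
  ring

/-- The change of coordinates `(s, x, v₁, v₂) ↦ (s, s + x, s + δ v₁, s + x + δ v₂)`. -/
def scaledCoords (δ : ℝ) (q : ℝ × ℝ × ℝ × ℝ) : ℝ × ℝ × ℝ × ℝ :=
  (q.1, q.1 + q.2.1, q.1 + δ * q.2.2.1, q.1 + q.2.1 + δ * q.2.2.2)

lemma measurePreserving_scaledCoords {δ : ℝ} (hδ : 0 < δ) :
    MeasurePreserving (scaledCoords δ) (ENNReal.ofReal (δ ^ 2) • volume) volume := by
  have h0 : ∀ a : ℝ, MeasurePreserving (fun v : ℝ => a + δ * v)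
      (ENNReal.ofReal δ • volume) volume := fun a => by
    refine (measurePreserving_add_left volume a).comp ⟨by fun_prop, ?_⟩
    have := Real.smul_map_volume_mul_left hδ.ne'
    rwa [abs_of_pos hδ, ← Measure.map_smul] at this
  have h1 : ∀ s : ℝ, MeasurePreserving
      (fun q : ℝ × ℝ × ℝ => (s + q.1, s + δ * q.2.1, s + q.1 + δ * q.2.2))
      ((volume : Measure ℝ).prod
        ((ENNReal.ofReal δ • (volume : Measure ℝ)).prod (ENNReal.ofReal δ • volume)))
      (volume.prod (volume.prod volume)) := fun s =>
    (measurePreserving_add_left volume s).skew_product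
      (g := fun x (q : ℝ × ℝ) => (s + δ * q.1, s + x + δ * q.2)) (by fun_prop)
      (ae_of_all _ fun x => ((h0 s).prod (h0 (s + x))).map_eq)
  have h2 := (MeasurePreserving.id (volume : Measure ℝ)).skew_product
    (g := fun s (q : ℝ × ℝ × ℝ) => (s + q.1, s + δ * q.2.1, s + q.1 + δ * q.2.2))
    (by fun_prop) (ae_of_all _ fun s => (h1 s).map_eq)
  have e : (volume : Measure ℝ).prod ((volume : Measure ℝ).prod
        ((ENNReal.ofReal δ • (volume : Measure ℝ)).prod (ENNReal.ofReal δ • volume))) =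
      ENNReal.ofReal (δ ^ 2) • (volume : Measure (ℝ × ℝ × ℝ × ℝ)) := by
    simp only [Measure.prod_smul_left, Measure.prod_smul_right, smul_smul]
    rw [← ENNReal.ofReal_mul hδ.le, ← sq]
    rfl
  rw [e] at h2
  exact h2

lemma measurableSet_regS (T : ℝ) : MeasurableSet (regS T) := by
  unfold regS
  measurability

lemma measurable_mu_comp {α : Type*} [MeasurableSpace α] (H : ℝ) {f g h : α → ℝ}
    (hf : Measurable f) (hg : Measurable g) (hh : Measurable h) :
    Measurable fun a => mu H (f a) (g a) (h a) := by
  unfold mu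
  fun_prop

/-- The integrand of the first-chaos variance in the coordinates `scaledCoords δ`, normalized
so that it has a limit as `δ → 0`. -/
noncomputable def scaledIntegrand (H T δ : ℝ) : ℝ × ℝ × ℝ × ℝ → ℝ :=
  (scaledCoords δ ⁻¹' regS T).indicator fun q =>
    (1 + q.2.2.1 ^ (2*H)) ^ (-(3/2 : ℝ)) * (1 + q.2.2.2 ^ (2*H)) ^ (-(3/2 : ℝ)) *
      (mu H q.2.1 (δ * q.2.2.1) (δ * q.2.2.2) / δ ^ 2)

lemma measurable_scaledIntegrand (H T δ : ℝ) : Measurable (scaledIntegrand H T δ) := by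
  refine Measurable.indicator ?_ ?_
  · have := measurable_mu_comp H (f := fun q : ℝ × ℝ × ℝ × ℝ => q.2.1)
      (g := fun q => δ * q.2.2.1) (h := fun q => δ * q.2.2.2)
      (by fun_prop) (by fun_prop) (by fun_prop)
    fun_prop
  · have : Measurable (scaledCoords δ) := by unfold scaledCoords; fun_prop
    exact this (measurableSet_regS T)

lemma nonneg_of_scaledCoords_mem {T δ : ℝ} (hδ : 0 < δ) {q : ℝ × ℝ × ℝ × ℝ}
    (hq : scaledCoords δ q ∈ regS T) :
    0 ≤ q.1 ∧ 0 ≤ q.2.1 ∧ q.1 + q.2.1 ≤ T ∧ 0 ≤ q.2.2.1 ∧ 0 ≤ q.2.2.2 := by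
  obtain ⟨h1, h2, -, -, h5, h6, h7⟩ := hq
  simp only [scaledCoords] at h1 h2 h5 h6 h7
  exact ⟨h1.1, by linarith, h2.2, nonneg_of_mul_nonneg_right (by linarith) hδ,
    nonneg_of_mul_nonneg_right (by linarith) hδ⟩

lemma rpow_mul_halfVarFirstChaos {H T δ : ℝ} (hH : 0 < H) (hδ : 0 < δ) :
    (δ ^ (2*H)) ^ (3 - 2/H) * halfVarFirstChaos H T (δ ^ (2*H)) =
      (1/π) * ∫ q, scaledIntegrand H T δ q := by
  have hmp := measurePreserving_scaledCoords hδ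
  set G : ℝ × ℝ × ℝ × ℝ → ℝ := fun p =>
    (δ ^ (2*H) + (p.2.2.1 - p.1) ^ (2*H)) ^ (-(3/2 : ℝ)) *
      (δ ^ (2*H) + (p.2.2.2 - p.2.1) ^ (2*H)) ^ (-(3/2 : ℝ)) *
      mu H (p.2.1 - p.1) (p.2.2.1 - p.1) (p.2.2.2 - p.2.1) with hG
  have hGm : Measurable ((regS T).indicator G) := by
    refine Measurable.indicator ?_ (measurableSet_regS T)
    have := measurable_mu_comp H (f := fun p : ℝ × ℝ × ℝ × ℝ => p.2.1 - p.1)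
      (g := fun p => p.2.2.1 - p.1) (h := fun p => p.2.2.2 - p.2.1)
      (by fun_prop) (by fun_prop) (by fun_prop)
    fun_prop
  have hcv : ∫ p in regS T, G p = δ ^ 2 * ∫ q, (regS T).indicator G (scaledCoords δ q) := by
    rw [← integral_indicator (measurableSet_regS T)]
    conv_lhs => rw [← hmp.map_eq]
    rw [integral_map hmp.measurable.aemeasurable hGm.aestronglyMeasurable, integral_smul_measure,
      ENNReal.toReal_ofReal (by positivity), smul_eq_mul]
  have hscale : ∀ v : ℝ, 0 ≤ v → (δ ^ (2*H) + (δ * v) ^ (2*H)) ^ (-(3/2 : ℝ)) =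
      δ ^ (-3*H) * (1 + v ^ (2*H)) ^ (-(3/2 : ℝ)) := fun v hv => by
    have h0 : 0 ≤ v ^ (2*H) := rpow_nonneg hv _
    rw [mul_rpow hδ.le hv, ← mul_one_add, mul_rpow (by positivity) (by positivity),
      ← rpow_mul hδ.le]
    ring_nf
  have hpt : ∀ q, (regS T).indicator G (scaledCoords δ q) =
      δ ^ (2 - 6*H) * scaledIntegrand H T δ q := fun q => by
    rw [scaledIntegrand]
    by_cases hq : scaledCoords δ q ∈ regS T
    · obtain ⟨-, -, -, hv₁, hv₂⟩ := nonneg_of_scaledCoords_mem hδ hq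
      have hd : δ ^ (2 - 6*H) = δ ^ (-3*H) * δ ^ (-3*H) * δ ^ 2 := by
        rw [← rpow_natCast, ← rpow_add hδ, ← rpow_add hδ]
        push_cast
        ring_nf
      rw [indicator_of_mem hq, indicator_of_mem (mem_preimage.2 hq), hd]
      simp only [hG, scaledCoords, add_sub_cancel_left, hscale _ hv₁, hscale _ hv₂]
      field_simp
    · rw [indicator_of_notMem hq, indicator_of_notMem (by exact hq), mul_zero]
  have hpow : (δ ^ (2*H)) ^ (3 - 2/H) * (δ ^ 2 * δ ^ (2 - 6*H)) = 1 := by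
    rw [← rpow_natCast, ← rpow_mul hδ.le, ← rpow_add hδ, ← rpow_add hδ]
    have : 2 * H * (3 - 2/H) + (((2:ℕ):ℝ) + (2 - 6*H)) = 0 := by
      push_cast
      field_simp
      ring
    rw [this, rpow_zero]
  rw [halfVarFirstChaos, hcv]
  simp only [hpt]
  rw [integral_const_mul]
  linear_combination (1/π) * (∫ q, scaledIntegrand H T δ q) * hpow

/-- The pointwise limit of `scaledIntegrand`. -/
noncomputable def limitIntegrand (H T : ℝ) (q : ℝ × ℝ × ℝ × ℝ) : ℝ :=
  H * (2*H - 1) * (Icc 0 T).indicator (fun s =>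
    (Ioo 0 (T - s)).indicator (fun x : ℝ => x ^ (2*H - 2)) q.2.1 *
      (profile H q.2.2.1 * profile H q.2.2.2)) q.1

/-- The dominating function for `scaledIntegrand`. -/
noncomputable def boundIntegrand (H T : ℝ) (q : ℝ × ℝ × ℝ × ℝ) : ℝ :=
  2 * H * ((Icc 0 T).indicator (fun _ => (1:ℝ)) q.1 *
    ((Ioc 0 T).indicator (fun x : ℝ => x ^ (2*H - 2)) q.2.1 *
      (profile H q.2.2.1 * profile H q.2.2.2)))

lemma integrable_boundIntegrand {H T : ℝ} (hT : 0 < T) (hH : 2/3 < H) :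
    Integrable (boundIntegrand H T) := by
  have h1 : Integrable ((Icc 0 T).indicator fun _ : ℝ => (1:ℝ)) :=
    (integrable_indicator_iff measurableSet_Icc).2 (integrableOn_const (by simp))
  have h2 : Integrable ((Ioc 0 T).indicator fun x : ℝ => x ^ (2*H - 2)) :=
    (integrable_indicator_iff measurableSet_Ioc).2
      ((intervalIntegrable_iff_integrableOn_Ioc_of_le hT.le).1
        (intervalIntegral.intervalIntegrable_rpow' (by linarith)))
  exact (h1.mul_prod (h2.mul_prod
    ((integrable_profile hH).mul_prod (integrable_profile hH)))).const_mul _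

lemma profile_nonneg (H v : ℝ) : 0 ≤ profile H v :=
  indicator_nonneg (fun v hv => by
    have h : 0 < v := hv
    positivity) v

lemma ae_generic (T : ℝ) : ∀ᵐ q : ℝ × ℝ × ℝ × ℝ,
    q.2.1 ≠ 0 ∧ q.1 + q.2.1 ≠ T ∧ q.2.2.1 ≠ 0 ∧ q.2.2.2 ≠ 0 := by
  have hne : ∀ c : ℝ, ∀ᵐ x : ℝ, x ≠ c := fun c => by simp [ae_iff]
  have q1 : Measure.QuasiMeasurePreserving (fun q : ℝ × ℝ × ℝ × ℝ => q.2) :=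
    Measure.quasiMeasurePreserving_snd
  have q2 : Measure.QuasiMeasurePreserving (fun q : ℝ × ℝ × ℝ => q.2) :=
    Measure.quasiMeasurePreserving_snd
  have q3 : Measure.QuasiMeasurePreserving (fun q : ℝ × ℝ × ℝ => q.1) :=
    Measure.quasiMeasurePreserving_fst
  have q4 : Measure.QuasiMeasurePreserving (fun q : ℝ × ℝ => q.1) :=
    Measure.quasiMeasurePreserving_fst
  have q5 : Measure.QuasiMeasurePreserving (fun q : ℝ × ℝ => q.2) :=
    Measure.quasiMeasurePreserving_snd
  have hA : MeasurePreserving (scaledCoords 1) := by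
    simpa using measurePreserving_scaledCoords one_pos
  have hx := (q3.comp q1).ae (hne 0)
  have hsx := ((q3.comp q1).comp hA.quasiMeasurePreserving).ae (hne T)
  have hv₁ := (q4.comp (q2.comp q1)).ae (hne 0)
  have hv₂ := (q5.comp (q2.comp q1)).ae (hne 0)
  filter_upwards [hx, hsx, hv₁, hv₂] with q h1 h2 h3 h4
  exact ⟨h1, h2, h3, h4⟩

lemma abs_scaledIntegrand_le {H T δ : ℝ} (hH : 1/2 < H) (hH1 : H ≤ 1) (hδ : 0 < δ)
    {q : ℝ × ℝ × ℝ × ℝ} (hx : q.2.1 ≠ 0) (hv₁ : q.2.2.1 ≠ 0) (hv₂ : q.2.2.2 ≠ 0) :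
    |scaledIntegrand H T δ q| ≤ boundIntegrand H T q := by
  obtain ⟨s, x, v₁, v₂⟩ := q
  simp only at hx hv₁ hv₂
  rw [scaledIntegrand, boundIntegrand]
  by_cases hq : scaledCoords δ (s, x, v₁, v₂) ∈ regS T
  · obtain ⟨hs, hx0, hsx, hv₁0, hv₂0⟩ := nonneg_of_scaledCoords_mem hδ hq
    simp only at hs hx0 hsx hv₁0 hv₂0
    replace hx0 := hx0.lt_of_ne' hx
    replace hv₁0 := hv₁0.lt_of_ne' hv₁
    replace hv₂0 := hv₂0.lt_of_ne' hv₂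
    rw [indicator_of_mem (mem_preimage.2 hq), indicator_of_mem (mem_Icc.2 ⟨hs, by linarith⟩),
      indicator_of_mem (mem_Ioc.2 ⟨hx0, by linarith⟩), profile,
      indicator_of_mem (mem_Ioi.2 hv₁0), indicator_of_mem (mem_Ioi.2 hv₂0)]
    simp only
    have hmu := abs_mu_le hH hH1 hx0 (mul_pos hδ hv₁0).le (mul_pos hδ hv₂0).le
    have hk₁ : 0 < (1 + v₁ ^ (2*H)) ^ (-(3/2 : ℝ)) := by positivity
    have hk₂ : 0 < (1 + v₂ ^ (2*H)) ^ (-(3/2 : ℝ)) := by positivity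
    rw [abs_mul, abs_mul, abs_of_pos hk₁, abs_of_pos hk₂, abs_div,
      abs_of_pos (by positivity : 0 < δ ^ 2)]
    have hdiv : |mu H x (δ * v₁) (δ * v₂)| / δ ^ 2 ≤
        2 * H * (v₁ * v₂ * x ^ (2*H - 2)) := by
      rw [div_le_iff₀ (by positivity)]
      linarith
    refine (mul_le_mul_of_nonneg_left hdiv (mul_pos hk₁ hk₂).le).trans_eq ?_
    ring
  · rw [indicator_of_notMem (by exact hq), abs_zero]
    refine mul_nonneg (by linarith) (mul_nonneg (indicator_nonneg (by simp) _)
      (mul_nonneg (indicator_nonneg (fun x hx => rpow_nonneg (le_of_lt hx.1) _) _)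
        (mul_nonneg (profile_nonneg _ _) (profile_nonneg _ _))))

lemma eventually_scaledCoords_mem {T s x v₁ v₂ : ℝ} (hs : 0 ≤ s) (hx : 0 < x)
    (hsx : s + x < T) (hv₁ : 0 < v₁) (hv₂ : 0 < v₂) :
    ∀ᶠ δ : ℝ in nhdsWithin 0 (Ioi 0), scaledCoords δ (s, x, v₁, v₂) ∈ regS T := by
  have h1 : ∀ᶠ δ : ℝ in nhds 0, s + δ * v₁ < T :=
    ((by fun_prop : Continuous fun δ : ℝ => s + δ * v₁).tendsto 0).eventually_lt_const
      (by linarith)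
  have h2 : ∀ᶠ δ : ℝ in nhds 0, s + x + δ * v₂ < T :=
    ((by fun_prop : Continuous fun δ : ℝ => s + x + δ * v₂).tendsto 0).eventually_lt_const
      (by linarith)
  filter_upwards [nhdsWithin_le_nhds h1, nhdsWithin_le_nhds h2, self_mem_nhdsWithin]
    with δ h1 h2 hδ
  have a1 : 0 < δ * v₁ := mul_pos hδ hv₁
  have a2 : 0 < δ * v₂ := mul_pos hδ hv₂
  simp only [regS, scaledCoords, mem_ofPred_eq, mem_Icc]
  refine ⟨⟨?_, ?_⟩, ⟨?_, ?_⟩, ⟨?_, ?_⟩, ⟨?_, ?_⟩, ?_, ?_, ?_⟩ <;> linarith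

lemma tendsto_scaledIntegrand {H T : ℝ} (hH : 1/2 < H) {q : ℝ × ℝ × ℝ × ℝ} (hx : q.2.1 ≠ 0)
    (hsx : q.1 + q.2.1 ≠ T) (hv₁ : q.2.2.1 ≠ 0) (hv₂ : q.2.2.2 ≠ 0) :
    Tendsto (fun δ => scaledIntegrand H T δ q) (nhdsWithin 0 (Ioi 0))
      (nhds (limitIntegrand H T q)) := by
  obtain ⟨s, x, v₁, v₂⟩ := q
  simp only at hx hsx hv₁ hv₂
  by_cases h : 0 ≤ s ∧ 0 < x ∧ s + x < T ∧ 0 < v₁ ∧ 0 < v₂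
  · obtain ⟨hs, hx0, hsxT, hv₁0, hv₂0⟩ := h
    rw [limitIntegrand, indicator_of_mem (mem_Icc.2 ⟨hs, by linarith⟩),
      indicator_of_mem (mem_Ioo.2 ⟨hx0, by linarith⟩), profile,
      indicator_of_mem (mem_Ioi.2 hv₁0), indicator_of_mem (mem_Ioi.2 hv₂0)]
    have hlim := (tendsto_mu_div_sq hH hx0 hv₁0 hv₂0).const_mul
      ((1 + v₁ ^ (2*H)) ^ (-(3/2 : ℝ)) * (1 + v₂ ^ (2*H)) ^ (-(3/2 : ℝ)))
    refine (hlim.congr' ?_).trans_eq (congrArg nhds ?_)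
    · filter_upwards [eventually_scaledCoords_mem hs hx0 hsxT hv₁0 hv₂0] with δ hδ
      rw [scaledIntegrand, indicator_of_mem (mem_preimage.2 hδ)]
    · ring
  · have hzero : limitIntegrand H T (s, x, v₁, v₂) = 0 := by
      contrapose! h
      simp only [limitIntegrand, profile, ne_eq, mul_eq_zero, not_or,
        indicator_apply_eq_zero, Classical.not_imp, mem_Icc, mem_Ioo, mem_Ioi] at h
      obtain ⟨-, ⟨hs, -⟩, ⟨⟨hx0, hxT⟩, -⟩, ⟨hv₁0, -⟩, hv₂0, -⟩ := h
      exact ⟨hs, hx0, by linarith, hv₁0, hv₂0⟩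
    rw [hzero]
    refine tendsto_const_nhds.congr' ?_
    filter_upwards [self_mem_nhdsWithin] with δ hδ
    rw [scaledIntegrand, indicator_of_notMem]
    intro hq
    obtain ⟨hs, hx0, hsxT, hv₁0, hv₂0⟩ := nonneg_of_scaledCoords_mem hδ hq
    exact h ⟨hs, hx0.lt_of_ne' hx, hsxT.lt_of_ne hsx, hv₁0.lt_of_ne' hv₁, hv₂0.lt_of_ne' hv₂⟩

lemma tendsto_integral_scaledIntegrand {H T : ℝ} (hT : 0 < T) (hH : 2/3 < H) (hH1 : H ≤ 1) :
    Tendsto (fun δ => ∫ q, scaledIntegrand H T δ q) (nhdsWithin 0 (Ioi 0))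
      (nhds (∫ q, limitIntegrand H T q)) := by
  refine tendsto_integral_filter_of_dominated_convergence (boundIntegrand H T)
    (Eventually.of_forall fun δ => (measurable_scaledIntegrand H T δ).aestronglyMeasurable)
    ?_ (integrable_boundIntegrand hT hH) ?_
  · filter_upwards [self_mem_nhdsWithin] with δ hδ
    filter_upwards [ae_generic T] with q ⟨hx, _, hv₁, hv₂⟩
    exact abs_scaledIntegrand_le (by linarith) hH1 hδ hx hv₁ hv₂
  · filter_upwards [ae_generic T] with q ⟨hx, hsx, hv₁, hv₂⟩
    exact tendsto_scaledIntegrand (by linarith) hx hsx hv₁ hv₂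

lemma integral_limitIntegrand {H T : ℝ} (hT : 0 < T) (hH : 2/3 < H) (hH1 : H ≤ 1) :
    ∫ q, limitIntegrand H T q = T ^ (2*H) / 2 * (∫ v, profile H v) ^ 2 := by
  have hint : Integrable (limitIntegrand H T) := by
    refine (integrable_boundIntegrand hT hH).mono' ?_ ?_
    · refine aestronglyMeasurable_of_tendsto_ae (nhdsWithin 0 (Ioi 0))
        (f := fun δ => scaledIntegrand H T δ)
        (fun δ => (measurable_scaledIntegrand H T δ).aestronglyMeasurable) ?_
      filter_upwards [ae_generic T] with q ⟨hx, hsx, hv₁, hv₂⟩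
      exact tendsto_scaledIntegrand (by linarith) hx hsx hv₁ hv₂
    · filter_upwards [ae_generic T] with q ⟨hx, hsx, hv₁, hv₂⟩
      refine le_of_tendsto (tendsto_scaledIntegrand (by linarith) hx hsx hv₁ hv₂).norm ?_
      filter_upwards [self_mem_nhdsWithin] with δ hδ
      exact abs_scaledIntegrand_le (by linarith) hH1 hδ hx hv₁ hv₂
  have hinner : ∀ s, ∫ r : ℝ × ℝ × ℝ, limitIntegrand H T (s, r) =
      (Icc 0 T).indicator (fun s => (T - s) ^ (2*H - 1)) s *
        (H * (∫ v, profile H v) ^ 2) := fun s => by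
    simp only [limitIntegrand]
    by_cases hs : s ∈ Icc 0 T
    · simp only [indicator_of_mem hs]
      have h1 := integral_prod_mul (μ := (volume : Measure ℝ))
        (ν := (volume : Measure (ℝ × ℝ)))
        ((Ioo 0 (T - s)).indicator fun x : ℝ => x ^ (2*H - 2))
        (fun v => profile H v.1 * profile H v.2)
      have h2 := integral_prod_mul (μ := (volume : Measure ℝ)) (ν := (volume : Measure ℝ))
        (profile H) (profile H)
      rw [← Measure.volume_eq_prod] at h1 h2
      rw [integral_const_mul, h1, h2, integral_indicator measurableSet_Ioo,
        ← integral_Ioc_eq_integral_Ioo, ← intervalIntegral.integral_of_le (by linarith [hs.2]),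
        integral_rpow (Or.inl (by linarith)), zero_rpow (by linarith),
        show 2*H - 2 + 1 = 2*H - 1 by ring]
      have hc : 2*H - 1 ≠ 0 := by linarith
      generalize 2*H - 1 = c at hc ⊢
      field_simp
      ring
    · simp [indicator_of_notMem hs]
  have houter : ∫ s, (Icc 0 T).indicator (fun s => (T - s) ^ (2*H - 1)) s =
      T ^ (2*H) / (2*H) := by
    rw [integral_indicator measurableSet_Icc, integral_Icc_eq_integral_Ioc,
      ← intervalIntegral.integral_of_le hT.le,
      intervalIntegral.integral_comp_sub_left (fun x : ℝ => x ^ (2*H - 1)) T, sub_self, sub_zero,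
      integral_rpow (Or.inl (by linarith)), sub_add_cancel, zero_rpow (by linarith), sub_zero]
  rw [Measure.volume_eq_prod] at hint ⊢
  rw [integral_prod _ hint]
  simp only [hinner]
  rw [integral_mul_const, houter]
  have : H ≠ 0 := by linarith
  field_simp

/-- For `2/3 < H < 1`,
`ε^{3-2/H} · (1/π) ∫_𝒮 (ε+(t₁-s₁)^{2H})^{-3/2}(ε+(t₂-s₂)^{2H})^{-3/2} μ_H → σ²` as `ε → 0⁺`,
where `σ² = T^{2H}(2H-1)/(4Hπ) · B(1/H, (3H-2)/(2H))² · B(2, 2H-1)`; equivalently,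
`ε^{3-2/H} 𝔼[I₁(f₁,ε)²] → σ²`. -/
theorem tendsto_variance_first_chaos (T : ℝ) (hT : 0 < T) (H : ℝ)
    (hH : H ∈ Ioo (2/3 : ℝ) 1) :
    Tendsto (fun ε : ℝ => ε ^ (3 - 2/H) * halfVarFirstChaos H T ε) (nhdsWithin 0 (Ioi 0))
      (nhds (T ^ (2*H) * (2*H - 1) / (4*H*π) *
        betaFn (1/H) ((3*H - 2) / (2*H)) ^ 2 * betaFn 2 (2*H - 1))) := by
  obtain ⟨hH, hH1⟩ := hH
  have hH0 : 0 < H := by linarith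
  have hlim := (tendsto_integral_scaledIntegrand hT hH hH1.le).const_mul (1/π)
  have hδ : Tendsto (fun ε : ℝ => ε ^ (2*H)⁻¹) (nhdsWithin 0 (Ioi 0)) (nhdsWithin 0 (Ioi 0)) := by
    refine tendsto_nhdsWithin_iff.2 ⟨?_, ?_⟩
    · have h := (continuous_rpow_const (q := (2*H)⁻¹) (by positivity)).tendsto 0
      rw [zero_rpow (by positivity)] at h
      exact h.mono_left nhdsWithin_le_nhds
    · filter_upwards [self_mem_nhdsWithin] with ε hε
      exact rpow_pos_of_pos hε _
  refine ((hlim.comp hδ).congr' ?_).trans_eq (congrArg nhds ?_)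
  · filter_upwards [self_mem_nhdsWithin] with ε hε
    have hε0 : 0 < ε := hε
    rw [Function.comp_apply, ← rpow_mul_halfVarFirstChaos hH0 (rpow_pos_of_pos hε0 _),
      rpow_inv_rpow hε0.le (by positivity)]
  · have h1 : 2*H - 1 ≠ 0 := by linarith
    rw [integral_limitIntegrand hT hH hH1.le, integral_profile hH, betaFn_two (by linarith),
      sub_add_cancel]
    field_simp
    ring
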